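/- For any fixed m, any fixed k < m, and any fixed p⃗ ∈ (0,1)^m, there exist constants c, C > 0 such that for all n ≥ 1, Pr_{P∼(π_{p⃗})^n}( top_k(p⃗) ⊆ EJR+(P) ) ≥ 1 − C·e^{−c·n}. -/

import Mathlib

/-- Probability of an approval set `A` under the independent approval distribution
`π_{p⃗}`: each alternative `i` is approved independently with probability `p i`. -/
noncomputable def iadProb (m : ℕ) (p : Fin m → ℝ) (A : Finset (Fin m)) : ℝ :=
  (∏ i ∈ A, p i) * ∏ i ∈ Aᶜ, (1 - p i)

open Classical in
/-- Probability that a profile of `n` i.i.d. `π_{p⃗}` approval preferences satisfies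
the event `Ev`. -/
noncomputable def prIAD (m n : ℕ) (p : Fin m → ℝ)
    (Ev : (Fin n → Finset (Fin m)) → Prop) : ℝ :=
  ∑ P : Fin n → Finset (Fin m), if Ev P then ∏ j, iadProb m p (P j) else 0

/-- `W` satisfies EJR+ at the profile `P` of `n` agents. -/
def inEJRplus (m k n : ℕ) (P : Fin n → Finset (Fin m)) (W : Finset (Fin m)) :
    Prop :=
  ¬ ∃ a : Fin m, a ∉ W ∧ ∃ ℓ : ℕ, 1 ≤ ℓ ∧ ℓ ≤ k ∧ ∃ S : Finset (Fin n),
    ℓ * n ≤ S.card * k ∧ ∀ j ∈ S, a ∈ P j ∧ (P j ∩ W).card < ℓ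

open Classical in
/-- The set `top_k(p⃗)` of `k`-committees whose approval probabilities dominate all
others. -/
noncomputable def topk (m k : ℕ) (p : Fin m → ℝ) : Finset (Finset (Fin m)) :=
  Finset.univ.filter fun W : Finset (Fin m) => W.card = k ∧
    ∀ i ∈ W, ∀ j : Fin m, j ∉ W → p j ≤ p i

open Finset

theorem iadProb_eq_prod_ite (m : ℕ) (p : Fin m → ℝ) (A : Finset (Fin m)) :
    iadProb m p A = ∏ i, if i ∈ A then p i else 1 - p i := by
  rw [iadProb, Finset.prod_ite]
  congr 2 <;> ext i <;> simp

theorem iadProb_nonneg (m : ℕ) (p : Fin m → ℝ) (hp : ∀ i, 0 < p i ∧ p i < 1)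
    (A : Finset (Fin m)) : 0 ≤ iadProb m p A := by
  rw [iadProb_eq_prod_ite]
  refine Finset.prod_nonneg fun i _ => ?_
  split_ifs <;> linarith [hp i]

theorem sum_iadProb (m : ℕ) (p : Fin m → ℝ) : ∑ A, iadProb m p A = 1 := by
  have h := Finset.prod_add p (fun i => 1 - p i) Finset.univ
  simp only [add_sub_cancel, Finset.prod_const_one, Finset.powerset_univ] at h
  rw [h]
  refine Finset.sum_congr rfl fun A _ => ?_
  rw [iadProb, Finset.compl_eq_univ_sdiff]

/-- Swapping an approved alternative for one that is at least as likely to be approved does not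
decrease the probability of an approval set. -/
theorem iadProb_le_iadProb_map_swap (m : ℕ) (p : Fin m → ℝ) (hp : ∀ i, 0 < p i ∧ p i < 1)
    {a b : Fin m} (hab : p a ≤ p b) (A : Finset (Fin m)) (ha : a ∈ A) :
    iadProb m p A ≤ iadProb m p (A.map (Equiv.swap a b).toEmbedding) := by
  have hmem : ∀ i, i ∈ A.map (Equiv.swap a b).toEmbedding ↔ Equiv.swap a b i ∈ A := by
    intro i
    rw [Finset.mem_map_equiv, Equiv.symm_swap]
  by_cases hb : b ∈ A
  · refine le_of_eq (congrArg _ (Finset.ext fun i => ?_))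
    rw [hmem]
    by_cases hia : i = a
    · subst hia; simp [ha, hb]
    by_cases hib : i = b
    · subst hib; simp [ha, hb]
    rw [Equiv.swap_apply_of_ne_of_ne hia hib]
  have hne : b ≠ a := fun h => hb (h ▸ ha)
  have hbe : b ∈ Finset.univ.erase a := by simp [hne]
  simp only [iadProb_eq_prod_ite, hmem]
  rw [← Finset.mul_prod_erase _ _ (Finset.mem_univ a), ← Finset.mul_prod_erase _ _ hbe,
    ← Finset.mul_prod_erase (a := a) _ _ (Finset.mem_univ a), ← Finset.mul_prod_erase _ _ hbe]
  simp only [Equiv.swap_apply_left, Equiv.swap_apply_right, ha, hb, if_true, if_false]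
  have hrest : ∏ i ∈ (Finset.univ.erase a).erase b,
        (if Equiv.swap a b i ∈ A then p i else 1 - p i) =
      ∏ i ∈ (Finset.univ.erase a).erase b, (if i ∈ A then p i else 1 - p i) := by
    refine Finset.prod_congr rfl fun i hi => ?_
    simp only [Finset.mem_erase, Finset.mem_univ, and_true] at hi
    rw [Equiv.swap_apply_of_ne_of_ne hi.2 hi.1]
  rw [hrest, ← mul_assoc, ← mul_assoc]
  refine mul_le_mul_of_nonneg_right (by nlinarith) (Finset.prod_nonneg fun i _ => ?_)
  split_ifs <;> linarith [hp i]

/-- Within `T`, a less likely alternative is less likely to be approved together with at most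
`ℓ` members of `T`. -/
theorem sum_iadProb_mem_card_le_mono (m ℓ : ℕ) (p : Fin m → ℝ) (hp : ∀ i, 0 < p i ∧ p i < 1)
    (T : Finset (Fin m)) {a b : Fin m} (ha : a ∈ T) (hb : b ∈ T) (hab : p a ≤ p b) :
    (∑ A, iadProb m p A * if a ∈ A ∧ #(A ∩ T) ≤ ℓ then 1 else 0) ≤
      ∑ A, iadProb m p A * if b ∈ A ∧ #(A ∩ T) ≤ ℓ then 1 else 0 := by
  have hT : T.map (Equiv.swap a b).toEmbedding = T := by
    ext i
    rw [Finset.mem_map_equiv, Equiv.symm_swap]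
    by_cases hia : i = a
    · subst hia; simp [ha, hb]
    by_cases hib : i = b
    · subst hib; simp [ha, hb]
    rw [Equiv.swap_apply_of_ne_of_ne hia hib]
  rw [← Equiv.sum_comp (Equiv.swap a b).finsetCongr
    (fun A => iadProb m p A * if b ∈ A ∧ #(A ∩ T) ≤ ℓ then 1 else 0)]
  refine Finset.sum_le_sum fun A _ => ?_
  have hcard : #(A.map (Equiv.swap a b).toEmbedding ∩ T) = #(A ∩ T) := by
    conv_lhs => rw [← hT, ← Finset.map_inter, Finset.card_map]
  have hmem : b ∈ A.map (Equiv.swap a b).toEmbedding ↔ a ∈ A := by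
    rw [Finset.mem_map_equiv, Equiv.symm_swap, Equiv.swap_apply_right]
  simp only [Equiv.finsetCongr_apply, hcard, hmem]
  split_ifs with h
  · simpa using iadProb_le_iadProb_map_swap m p hp hab A h.1
  · simp

/-- An alternative that is least likely in `T` is approved together with at most `ℓ` members
of `T` with probability at most `ℓ / #T`. -/
theorem card_mul_sum_iadProb_mem_card_le (m ℓ : ℕ) (p : Fin m → ℝ)
    (hp : ∀ i, 0 < p i ∧ p i < 1) (T : Finset (Fin m)) {a : Fin m} (ha : a ∈ T)
    (hmin : ∀ b ∈ T, p a ≤ p b) :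
    #T * (∑ A, iadProb m p A * if a ∈ A ∧ #(A ∩ T) ≤ ℓ then 1 else 0) ≤ ℓ := by
  rw [← nsmul_eq_mul]
  refine (Finset.card_nsmul_le_sum T _ _ fun b hb =>
    sum_iadProb_mem_card_le_mono m ℓ p hp T ha hb (hmin b hb)).trans ?_
  rw [Finset.sum_comm]
  calc _ ≤ ∑ A, iadProb m p A * (ℓ : ℝ) := ?_
    _ = ℓ := by rw [← Finset.sum_mul, sum_iadProb, one_mul]
  refine Finset.sum_le_sum fun A _ => ?_
  rw [← Finset.mul_sum]
  refine mul_le_mul_of_nonneg_left ?_ (iadProb_nonneg m p hp A)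
  by_cases h : #(A ∩ T) ≤ ℓ
  · simp only [h, and_true, Finset.sum_boole, Finset.filter_mem_eq_inter]
    rw [Finset.inter_comm]
    exact_mod_cast h
  · simp [h]

/-- The probability that a voter supports an EJR+ deviation at level `ℓ` is bounded away from
`ℓ / k`. -/
theorem sum_iadProb_supports_le (m k ℓ : ℕ) (p : Fin m → ℝ) (hp : ∀ i, 0 < p i ∧ p i < 1)
    (W : Finset (Fin m)) (hW : W ∈ topk m k p) {a : Fin m} (ha : a ∉ W) :
    (∑ A, iadProb m p A * if a ∈ A ∧ #(A ∩ W) < ℓ then 1 else 0) ≤ ℓ / (k + 1) := by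
  simp only [topk, Finset.mem_filter, Finset.mem_univ, true_and] at hW
  have h := card_mul_sum_iadProb_mem_card_le m ℓ p hp (insert a W) (Finset.mem_insert_self a W)
    (fun b hb => by
      rcases Finset.mem_insert.mp hb with rfl | hb
      · exact le_rfl
      · exact hW.2 b hb a ha)
  have hiff : ∀ A, a ∈ A ∧ #(A ∩ insert a W) ≤ ℓ ↔ a ∈ A ∧ #(A ∩ W) < ℓ := fun A => by
    refine and_congr_right fun haA => ?_
    rw [Finset.inter_insert_of_mem haA, Finset.card_insert_of_notMem (by simp [ha]),
      Nat.succ_le_iff]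
  simp only [Finset.card_insert_of_notMem ha, hW.1, hiff] at h
  rw [le_div_iff₀ (by positivity), mul_comm]
  exact_mod_cast h

/-- Exponential moment bound for a centred Bernoulli variable. -/
theorem sum_iadProb_mul_exp_le (m : ℕ) (p : Fin m → ℝ) (hp : ∀ i, 0 < p i ∧ p i < 1)
    (B : Finset (Fin m) → Prop) [DecidablePred B] {t s : ℝ} (ht0 : 0 ≤ t) (ht1 : t ≤ 1) (hs0 : 0 ≤ s)
    (hs1 : s ≤ 1) (h : (∑ A, iadProb m p A * if B A then 1 else 0) ≤ t - 2 * s) :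
    ∑ A, iadProb m p A * Real.exp (s * ((if B A then 1 else 0) - t)) ≤ Real.exp (-s ^ 2) := by
  have hexp : ∀ x : ℝ, |x| ≤ 1 → Real.exp (s * x) ≤ 1 + s * x + s ^ 2 := by
    intro x hx
    have hsx : |s * x| ≤ s := by
      rw [abs_mul, abs_of_nonneg hs0]
      exact mul_le_of_le_one_right hs0 hx
    have h1 := (abs_le.mp (Real.abs_exp_sub_one_sub_id_le (hsx.trans hs1))).2
    have h2 : (s * x) ^ 2 ≤ s ^ 2 := sq_le_sq' (by linarith [(abs_le.mp hsx).1])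
      (abs_le.mp hsx).2
    linarith
  calc _ ≤ ∑ A, iadProb m p A * (1 + s * ((if B A then 1 else 0) - t) + s ^ 2) := by
        refine Finset.sum_le_sum fun A _ =>
          mul_le_mul_of_nonneg_left (hexp _ ?_) (iadProb_nonneg m p hp A)
        rw [abs_le]
        split_ifs <;> constructor <;> linarith
    _ = (1 - s * t + s ^ 2) * (∑ A, iadProb m p A) +
          s * ∑ A, iadProb m p A * if B A then 1 else 0 := by
        rw [Finset.mul_sum, Finset.mul_sum, ← Finset.sum_add_distrib]
        exact Finset.sum_congr rfl fun A _ => by ring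
    _ ≤ 1 + -s ^ 2 := by
        rw [sum_iadProb]
        nlinarith [mul_le_mul_of_nonneg_left h hs0]
    _ ≤ Real.exp (-s ^ 2) := by linarith [Real.add_one_le_exp (-s ^ 2)]

theorem sum_prod_iadProb_mul (m n : ℕ) (p : Fin m → ℝ) (g : Finset (Fin m) → ℝ) :
    ∑ P : Fin n → Finset (Fin m), (∏ j, iadProb m p (P j)) * ∏ j, g (P j) =
      (∑ A, iadProb m p A * g A) ^ n := by
  rw [Fintype.sum_pow]
  exact Finset.sum_congr rfl fun P _ => Finset.prod_mul_distrib.symm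

/-- Union bound: if every profile violating `Ev` is charged by one of the product weights,
`Ev` has probability at least one minus the total weight. -/
theorem one_sub_sum_pow_le_prIAD {ι : Type*} (m n : ℕ) (p : Fin m → ℝ)
    (hp : ∀ i, 0 < p i ∧ p i < 1) (Ev : (Fin n → Finset (Fin m)) → Prop) (I : Finset ι)
    (g : ι → Finset (Fin m) → ℝ) (hg : ∀ x ∈ I, ∀ A, 0 ≤ g x A)
    (hEv : ∀ P, ¬ Ev P → ∃ x ∈ I, 1 ≤ ∏ j, g x (P j)) :
    1 - ∑ x ∈ I, (∑ A, iadProb m p A * g x A) ^ n ≤ prIAD m n p Ev := by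
  have hone : ∑ P : Fin n → Finset (Fin m), ∏ j, iadProb m p (P j) = 1 := by
    simpa [sum_iadProb] using sum_prod_iadProb_mul m n p fun _ => 1
  simp only [← sum_prod_iadProb_mul]
  rw [Finset.sum_comm, ← hone, ← Finset.sum_sub_distrib, prIAD]
  refine Finset.sum_le_sum fun P _ => ?_
  have hP : 0 ≤ ∏ j, iadProb m p (P j) :=
    Finset.prod_nonneg fun j _ => iadProb_nonneg m p hp (P j)
  have hgP : ∀ x ∈ I, 0 ≤ ∏ j, g x (P j) :=
    fun x hx => Finset.prod_nonneg fun j _ => hg x hx (P j)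
  rw [← Finset.mul_sum]
  split_ifs with h
  · linarith [mul_nonneg hP (Finset.sum_nonneg hgP)]
  · obtain ⟨x, hx, h1⟩ := hEv P h
    have h2 : 1 ≤ ∑ x ∈ I, ∏ j, g x (P j) :=
      h1.trans (Finset.single_le_sum (f := fun x => ∏ j, g x (P j)) hgP hx)
    linarith [mul_le_mul_of_nonneg_left h2 hP]

theorem one_le_prod_exp_of_card {α : Type*} {n k ℓ : ℕ} (hk : 1 ≤ k) {s : ℝ} (hs : 0 ≤ s)
    (B : α → Prop) [DecidablePred B] (P : Fin n → α) (S : Finset (Fin n)) (hS : ℓ * n ≤ #S * k)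
    (hB : ∀ j ∈ S, B (P j)) :
    1 ≤ ∏ j, Real.exp (s * ((if B (P j) then 1 else 0) - (ℓ : ℝ) / k)) := by
  rw [← Real.exp_sum, ← Finset.mul_sum, Finset.sum_sub_distrib]
  refine Real.one_le_exp (mul_nonneg hs (sub_nonneg.mpr ?_))
  have hk0 : (0 : ℝ) < k := by exact_mod_cast hk
  have hcard : #S ≤ #{j | B (P j)} :=
    Finset.card_le_card fun j hj => by simpa using hB j hj
  rw [Finset.sum_boole, Finset.sum_const, Finset.card_univ, Fintype.card_fin, nsmul_eq_mul,
    ← mul_div_assoc, div_le_iff₀ hk0, mul_comm]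
  exact_mod_cast hS.trans (Nat.mul_le_mul_right k hcard)

/-- under any independent approval distribution with
`p⃗ ∈ (0,1)^m`, the probability that every committee in `top_k(p⃗)` satisfies EJR+
is at least `1 − C·e^{−cn}`. -/
theorem topk_in_ejrplus (m k : ℕ) (hk : 1 ≤ k) (hkm : k < m)
    (p : Fin m → ℝ) (hp : ∀ i, 0 < p i ∧ p i < 1) :
    ∃ c C : ℝ, 0 < c ∧ 0 < C ∧ ∀ n : ℕ, 1 ≤ n →
      1 - C * Real.exp (-(c * n)) ≤
        prIAD m n p (fun P => ∀ W ∈ topk m k p, inEJRplus m k n P W) := by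
  classical
  have hk1 : (1 : ℝ) ≤ k := by exact_mod_cast hk
  obtain ⟨s, hs⟩ : ∃ s : ℝ, s = 1 / (2 * (k * (k + 1))) := ⟨_, rfl⟩
  have hs0 : 0 < s := by rw [hs]; positivity
  have hs1 : s ≤ 1 := by
    rw [hs, div_le_one (by positivity)]
    nlinarith
  let I : Finset (Finset (Fin m) × Fin m × ℕ) :=
    {x ∈ topk m k p ×ˢ Finset.univ ×ˢ Finset.Icc 1 k | x.2.1 ∉ x.1}
  refine ⟨s ^ 2, #I + 1, by positivity, by positivity, fun n _ => ?_⟩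
  refine le_trans ?_ (one_sub_sum_pow_le_prIAD m n p hp _ I
    (fun x A => Real.exp (s * ((if x.2.1 ∈ A ∧ #(A ∩ x.1) < x.2.2 then 1 else 0) - (x.2.2 : ℝ) / k)))
    (fun _ _ _ => (Real.exp_pos _).le) ?_)
  · have hpow : Real.exp (-(s ^ 2 * n)) = Real.exp (-s ^ 2) ^ n := by
      rw [← Real.exp_nat_mul]
      ring_nf
    rw [hpow]
    have hsum := Finset.sum_le_card_nsmul I
      (fun x => (∑ A, iadProb m p A *
        Real.exp (s * ((if x.2.1 ∈ A ∧ #(A ∩ x.1) < x.2.2 then 1 else 0) - (x.2.2 : ℝ) / k))) ^ n)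
      (Real.exp (-s ^ 2) ^ n) ?_
    · rw [nsmul_eq_mul] at hsum
      have := pow_pos (Real.exp_pos (-s ^ 2)) n
      linarith
    · rintro ⟨W, a, ℓ⟩ hx
      simp only [I, Finset.mem_filter, Finset.mem_product, Finset.mem_univ, true_and,
        Finset.mem_Icc] at hx
      obtain ⟨⟨hW, hℓ1, hℓk⟩, ha⟩ := hx
      have hℓ1' : (1 : ℝ) ≤ ℓ := by exact_mod_cast hℓ1
      have hℓk' : (ℓ : ℝ) ≤ k := by exact_mod_cast hℓk
      refine pow_le_pow_left₀ (Finset.sum_nonneg fun A _ =>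
        mul_nonneg (iadProb_nonneg m p hp A) (Real.exp_pos _).le) ?_ n
      refine sum_iadProb_mul_exp_le m p hp (fun A => a ∈ A ∧ #(A ∩ W) < ℓ) (by positivity)
        (div_le_one_of_le₀ hℓk' (by positivity)) hs0.le hs1 ?_
      have hgap : (ℓ : ℝ) / (k + 1) ≤ ℓ / k - 2 * s := by
        have : (ℓ : ℝ) / k - 2 * s - ℓ / (k + 1) = (ℓ - 1) / (k * (k + 1)) := by
          rw [hs]
          field_simp
          ring
        have : 0 ≤ ((ℓ : ℝ) - 1) / (k * (k + 1)) :=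
          div_nonneg (by linarith) (by positivity)
        linarith
      exact (sum_iadProb_supports_le m k ℓ p hp W hW ha).trans hgap
  · intro P hP
    simp only [inEJRplus] at hP
    push Not at hP
    obtain ⟨W, hW, a, ha, ℓ, hℓ1, hℓk, S, hS, hB⟩ := hP
    exact ⟨(W, a, ℓ), by simp [I, hW, ha, hℓ1, hℓk],
      one_le_prod_exp_of_card hk hs0.le (fun A => a ∈ A ∧ #(A ∩ W) < ℓ) P S hS hB⟩
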